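/- Let B be an associative unital k-algebra, W a k-vector space with distinguished element 1_W, and let P: B⊗W → W⊗B and ν: W⊗W → W⊗B satisfy the mirror Brzeziński crossed product conditions. Then the mirror Brzeziński crossed product W ⊗̄_{P,ν} B, namely the vector space W⊗B with multiplication (w⊗b)(w'⊗b') = ν₁(w,w'_P) ⊗ ν₂(w,w'_P) b_P b' (P applied to b⊗w'), is an associative unital algebra with unit 1_W⊗1_B. -/

import Mathlib

open TensorProduct LinearMap

noncomputable section

variable {k : Type*} [Field k]

section Helpers

variable {M N P Q : Type*}
  [AddCommMonoid M] [AddCommMonoid N] [AddCommMonoid P] [AddCommMonoid Q]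
  [Module k M] [Module k N] [Module k P] [Module k Q]

def aso : (M ⊗[k] N) ⊗[k] P →ₗ[k] M ⊗[k] (N ⊗[k] P) :=
  (TensorProduct.assoc k M N P).toLinearMap

def osa : M ⊗[k] (N ⊗[k] P) →ₗ[k] (M ⊗[k] N) ⊗[k] P :=
  (TensorProduct.assoc k M N P).symm.toLinearMap

def cc : M ⊗[k] N →ₗ[k] N ⊗[k] M := (TensorProduct.comm k M N).toLinearMap

def lc : M ⊗[k] (N ⊗[k] P) →ₗ[k] N ⊗[k] (M ⊗[k] P) :=
  (TensorProduct.leftComm k M N P).toLinearMap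

def tt : (M ⊗[k] N) ⊗[k] (P ⊗[k] Q) →ₗ[k] (M ⊗[k] P) ⊗[k] (N ⊗[k] Q) :=
  (TensorProduct.tensorTensorTensorComm k M N P Q).toLinearMap

end Helpers

section LRCrossed

variable (k)
variable (H U : Type*) [Ring H] [Algebra k H] [AddCommGroup U] [Module k U]

abbrev mH : H ⊗[k] H →ₗ[k] H := LinearMap.mul' k H

def dR : (H ⊗[k] H) ⊗[k] H →ₗ[k] H ⊗[k] H :=
  rTensor H (mH k H) ∘ₗ osa ∘ₗ lTensor H cc ∘ₗ aso

/-- `d ⊗ (g ⊗ i) ↦ (d*g) ⊗ i`. -/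
def dL : H ⊗[k] (H ⊗[k] H) →ₗ[k] H ⊗[k] H :=
  rTensor H (mH k H) ∘ₗ osa

/-- `(g ⊗ i) ⊗ d ↦ g ⊗ (d*i)`. -/
def eR : (H ⊗[k] H) ⊗[k] H →ₗ[k] H ⊗[k] H :=
  lTensor H ((mH k H) ∘ₗ cc) ∘ₗ aso

/-- `d ⊗ (g ⊗ i) ↦ g ⊗ (i*d)`. -/
def eL : H ⊗[k] (H ⊗[k] H) →ₗ[k] H ⊗[k] H :=
  lTensor H ((mH k H) ∘ₗ cc) ∘ₗ lc

/-- `(g ⊗ i) ⊗ (a ⊗ b) ↦ (g*a) ⊗ (b*i)`. -/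
def mulLR : (H ⊗[k] H) ⊗[k] (H ⊗[k] H) →ₗ[k] H ⊗[k] H :=
  TensorProduct.map (mH k H) ((mH k H) ∘ₗ cc) ∘ₗ tt


def w12 : H ⊗[k] (H ⊗[k] H) →ₗ[k] H ⊗[k] H :=
  lTensor H ((mH k H) ∘ₗ cc) ∘ₗ lc ∘ₗ lTensor H cc

def inner12 : (H ⊗[k] H) ⊗[k] (H ⊗[k] H) →ₗ[k] H ⊗[k] H :=
  lTensor H ((mH k H) ∘ₗ cc) ∘ₗ aso ∘ₗ lTensor (H ⊗[k] H) ((mH k H) ∘ₗ cc)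

/-- `(g ⊗ i) ⊗ (b ⊗ (d ⊗ e)) ↦ g * d * e * b * i`. -/
def omegaM : (H ⊗[k] H) ⊗[k] (H ⊗[k] (H ⊗[k] H)) →ₗ[k] H :=
  (mH k H) ∘ₗ
    TensorProduct.map (mH k H) ((mH k H) ∘ₗ rTensor H (mH k H) ∘ₗ cc) ∘ₗ
    tt ∘ₗ lTensor (H ⊗[k] H) (lTensor H cc ∘ₗ lc)

variable {H U}
variable (J : H ⊗[k] U →ₗ[k] U ⊗[k] H) (T : U ⊗[k] H →ₗ[k] U ⊗[k] H)
variable (γ : U ⊗[k] U →ₗ[k] U ⊗[k] (U ⊗[k] H))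
variable (η : U ⊗[k] U →ₗ[k] U ⊗[k] (H ⊗[k] H))

variable (oneU : U)

/-- Axiom (1): `J(h ⊗ 1_U) = 1_U ⊗ h` and `J(1_H ⊗ u) = u ⊗ 1_H`. -/
def LRax1 : Prop :=
  (∀ h : H, J (h ⊗ₜ oneU) = oneU ⊗ₜ h) ∧ (∀ u : U, J ((1 : H) ⊗ₜ u) = u ⊗ₜ (1 : H))

/-- Axiom (2): `T(u ⊗ 1_H) = u ⊗ 1_H` and `T(1_U ⊗ h) = 1_U ⊗ h`. -/
def LRax2 : Prop :=
  (∀ u : U, T (u ⊗ₜ (1 : H)) = u ⊗ₜ (1 : H)) ∧ (∀ h : H, T (oneU ⊗ₜ h) = oneU ⊗ₜ h)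

/-- Axiom (3): `γ(u ⊗ 1_U) = u ⊗ 1_U ⊗ 1_H` and `γ(1_U ⊗ u) = 1_U ⊗ u ⊗ 1_H`. -/
def LRax3 : Prop :=
  (∀ u : U, γ (u ⊗ₜ oneU) = u ⊗ₜ (oneU ⊗ₜ (1 : H))) ∧
  (∀ u : U, γ (oneU ⊗ₜ u) = oneU ⊗ₜ (u ⊗ₜ (1 : H)))

/-- Axiom (4): `η(u ⊗ 1_U) = η(1_U ⊗ u) = u ⊗ 1_H ⊗ 1_H`. -/
def LRax4 : Prop :=
  (∀ u : U, η (u ⊗ₜ oneU) = u ⊗ₜ ((1 : H) ⊗ₜ (1 : H))) ∧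
  (∀ u : U, η (oneU ⊗ₜ u) = u ⊗ₜ ((1 : H) ⊗ₜ (1 : H)))

/-- Axiom (5): `u_J ⊗ (hh')_J = (u_J)_j ⊗ h_j h'_J`. -/
def LRax5 : Prop := ∀ (h h' : H) (u : U),
  J ((h * h') ⊗ₜ u) =
    lTensor U (mH k H) (aso (rTensor H J (osa (h ⊗ₜ (J (h' ⊗ₜ u))))))

/-- Axiom (6): `u_T ⊗ (hh')_T = (u_T)_t ⊗ h_T h'_t`. -/
def LRax6 : Prop := ∀ (u : U) (h h' : H),
  T (u ⊗ₜ (h * h')) =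
    lTensor U ((mH k H) ∘ₗ cc)
      (aso (rTensor H T (osa (lTensor U cc (aso ((T (u ⊗ₜ h)) ⊗ₜ h'))))))

/-- Axiom (7):
`η₁(u_J,u'_j) ⊗ η₂(u_J,u'_j)(h_J)_j ⊗ η₃(u_J,u'_j) = η₁(u,u')_J ⊗ h_J η₂(u,u') ⊗ η₃(u,u')`. -/
def LRax7 : Prop := ∀ (h : H) (u u' : U),
  lTensor U (dR k H)
      (aso (rTensor H η (osa (lTensor U J (aso ((J (h ⊗ₜ u)) ⊗ₜ u'))))))
  = lTensor U (dL k H)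
      (aso (rTensor (H ⊗[k] H) J (osa (h ⊗ₜ (η (u ⊗ₜ u'))))))

/-- Axiom (8):
`η₁(u_t,u'_T) ⊗ η₂(u_t,u'_T) ⊗ (h_T)_t η₃(u_t,u'_T) = η₁(u,u')_T ⊗ η₂(u,u') ⊗ η₃(u,u')h_T`. -/
def LRax8 : Prop := ∀ (u u' : U) (h : H),
  lTensor U (eR k H)
      (aso (rTensor H η (osa (lTensor U cc
        (aso (rTensor U T (osa (lTensor U cc (u ⊗ₜ (T (u' ⊗ₜ h)))))))))))
  = lTensor U (eL k H)
      (aso (rTensor (H ⊗[k] H) T (osa (lTensor U cc (aso ((η (u ⊗ₜ u')) ⊗ₜ h))))))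

/-- Axiom (9). -/
def LRax9 : Prop := ∀ (u u' u'' : U),
  lTensor U (mulLR k H)
      (aso (rTensor (H ⊗[k] H) η (osa (lTensor U (aso (P := H))
        ((lTensor U (rTensor H J ∘ₗ osa ∘ₗ lTensor H cc ∘ₗ aso))
          (aso ((η (u ⊗ₜ u')) ⊗ₜ u'')))))))
  = lTensor U ((mulLR k H) ∘ₗ lTensor (H ⊗[k] H) cc)
      (aso (rTensor (H ⊗[k] H) η (tt (rTensor (U ⊗[k] H) T
        (osa (lTensor U (lc ∘ₗ lTensor U cc) (u ⊗ₜ (η (u' ⊗ₜ u'')))))))))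


def qJ : (U ⊗[k] H) ⊗[k] H →ₗ[k] U ⊗[k] H :=
  lTensor U (mH k H) ∘ₗ aso ∘ₗ rTensor H J ∘ₗ osa ∘ₗ lc ∘ₗ lTensor U cc ∘ₗ aso

/-- Axiom (10). -/
def LRax10 : Prop := ∀ (u u' : U) (h : H),
  lTensor U (lTensor U ((mH k H) ∘ₗ cc))
      (aso (tt (rTensor (U ⊗[k] H) T (osa (lTensor U cc
        (aso (rTensor H γ (osa (u ⊗ₜ (J (h ⊗ₜ u')))))))))))
  = lTensor U (qJ k J)
      (aso (rTensor H γ (osa (lTensor U cc (aso ((T (u ⊗ₜ h)) ⊗ₜ u'))))))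

def psi11 : (U ⊗[k] H) ⊗[k] (H ⊗[k] H) →ₗ[k] U ⊗[k] (H ⊗[k] H) :=
  lTensor U (rTensor H (mH k H) ∘ₗ osa) ∘ₗ aso

def chainX : (U ⊗[k] H) ⊗[k] (U ⊗[k] H) →ₗ[k] U ⊗[k] (H ⊗[k] H) :=
  (lTensor U ((dR k H) ∘ₗ lTensor (H ⊗[k] H) (mH k H))) ∘ₗ aso ∘ₗ
    rTensor (H ⊗[k] H) η ∘ₗ rTensor (H ⊗[k] H) cc ∘ₗ tt ∘ₗ
    lTensor (U ⊗[k] H) cc ∘ₗ rTensor (H ⊗[k] U) J ∘ₗ rTensor (H ⊗[k] U) cc ∘ₗ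
    tt ∘ₗ lTensor (U ⊗[k] H) cc

/-- Axiom (11). -/
def LRax11 : Prop := ∀ (u u' u'' : U),
  lTensor U (psi11 k)
      (aso (tt (rTensor ((U ⊗[k] H) ⊗[k] H) T (tt (rTensor (H ⊗[k] H) γ
        (osa (u ⊗ₜ (η (u' ⊗ₜ u'')))))))))
  = lTensor U (chainX k J η)
      (aso (rTensor (U ⊗[k] H) γ (osa (lTensor U cc
        (aso ((γ (u ⊗ₜ u')) ⊗ₜ u''))))))

def chain12 : (U ⊗[k] H) ⊗[k] (H ⊗[k] H) →ₗ[k] U ⊗[k] (H ⊗[k] H) :=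
  (lTensor U (w12 k H)) ∘ₗ aso ∘ₗ tt ∘ₗ rTensor (H ⊗[k] H) J ∘ₗ
    rTensor (H ⊗[k] H) cc ∘ₗ tt ∘ₗ lTensor (U ⊗[k] H) cc

def big12 : (H ⊗[k] H) ⊗[k] (H ⊗[k] (U ⊗[k] H)) →ₗ[k] U ⊗[k] (H ⊗[k] H) :=
  lTensor U (inner12 k H) ∘ₗ lc ∘ₗ lTensor (H ⊗[k] H) lc

/-- Axiom (12). -/
def LRax12 : Prop := ∀ (u u' u'' : U),
  lTensor U (chain12 k J)
      (aso (rTensor (H ⊗[k] H) γ (osa (lTensor U cc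
        (aso ((η (u ⊗ₜ u')) ⊗ₜ u''))))))
  = lTensor U (big12 k)
      (aso (rTensor (H ⊗[k] (U ⊗[k] H)) η (tt (lTensor (U ⊗[k] H) cc
        (rTensor ((U ⊗[k] H) ⊗[k] U) T (tt (lTensor (U ⊗[k] (U ⊗[k] H)) cc
          (rTensor (U ⊗[k] H) γ (osa (lTensor U lc (u ⊗ₜ (γ (u' ⊗ₜ u'')))))))))))))

def w13 : H ⊗[k] (U ⊗[k] H) →ₗ[k] U ⊗[k] H :=
  lTensor U ((mH k H) ∘ₗ cc) ∘ₗ lc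

def xi2 : H ⊗[k] (U ⊗[k] H) →ₗ[k] U ⊗[k] H :=
  lTensor U (mH k H) ∘ₗ aso ∘ₗ rTensor H J ∘ₗ osa

def xi : H ⊗[k] (U ⊗[k] (U ⊗[k] H)) →ₗ[k] U ⊗[k] (U ⊗[k] H) :=
  lTensor U (xi2 k J) ∘ₗ lc

def rho : (U ⊗[k] H) ⊗[k] U →ₗ[k] (U ⊗[k] (U ⊗[k] H)) ⊗[k] H :=
  rTensor H γ ∘ₗ osa ∘ₗ lTensor U cc ∘ₗ aso

def chainR : ((U ⊗[k] (U ⊗[k] H)) ⊗[k] H) ⊗[k] H →ₗ[k] (U ⊗[k] H) ⊗[k] (U ⊗[k] H) :=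
  tt ∘ₗ lTensor (U ⊗[k] U) cc ∘ₗ
    lTensor (U ⊗[k] U) (rTensor H ((mH k H) ∘ₗ cc) ∘ₗ osa) ∘ₗ tt ∘ₗ
    lTensor (U ⊗[k] H) aso ∘ₗ rTensor ((U ⊗[k] H) ⊗[k] H) T ∘ₗ tt ∘ₗ
    lTensor (U ⊗[k] (U ⊗[k] H)) cc ∘ₗ aso

/-- The composite computing the right-hand side of axiom (13). -/
def rhs13 : ((H ⊗[k] (U ⊗[k] U)) ⊗[k] U) ⊗[k] H →ₗ[k]
    (U ⊗[k] (U ⊗[k] H)) ⊗[k] (U ⊗[k] H) :=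
  osa ∘ₗ lTensor U (chainR k T) ∘ₗ aso ∘ₗ
    rTensor H (lTensor U (rho k γ) ∘ₗ aso ∘ₗ rTensor U ((xi k J) ∘ₗ lTensor H γ))

/-- Axiom (13). -/
def LRax13 : Prop := ∀ (u u' u'' : U) (h h' : H),
  rTensor (U ⊗[k] H) (xi k J)
      (osa (h' ⊗ₜ (lTensor (U ⊗[k] (U ⊗[k] H)) (w13 k)
        (aso (rTensor (U ⊗[k] H) (rTensor H γ) (rTensor (U ⊗[k] H) osa
          (osa (u ⊗ₜ (rTensor (U ⊗[k] H) T (osa (lTensor U cc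
            (aso ((γ (u' ⊗ₜ u'')) ⊗ₜ h)))))))))))))
  = rhs13 k J T γ (((h' ⊗ₜ (u ⊗ₜ u')) ⊗ₜ u'') ⊗ₜ h)

/-- The L-R-crossed product multiplication, as a linear map. -/
def lrM : (U ⊗[k] H) ⊗[k] (U ⊗[k] H) →ₗ[k] U ⊗[k] H :=
  lTensor U (omegaM k H) ∘ₗ aso ∘ₗ rTensor (H ⊗[k] (H ⊗[k] H)) η ∘ₗ tt ∘ₗ
    lTensor (U ⊗[k] H) aso ∘ₗ rTensor ((U ⊗[k] H) ⊗[k] H) T ∘ₗ tt ∘ₗ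
    lTensor (U ⊗[k] (U ⊗[k] H)) cc ∘ₗ
    rTensor (H ⊗[k] H) (lTensor U J ∘ₗ lTensor U cc ∘ₗ aso) ∘ₗ tt ∘ₗ
    rTensor (H ⊗[k] H) (osa ∘ₗ γ) ∘ₗ tt

/-- The L-R-crossed product multiplication of two elements of `U ⊗ H`. -/
def lrMul (x y : U ⊗[k] H) : U ⊗[k] H := lrM k J T γ η (x ⊗ₜ y)

end LRCrossed


section Mirror

variable {k : Type*} [Field k]
variable {B W : Type*} [Ring B] [Algebra k B] [AddCommGroup W] [Module k W] (oneW : W)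
variable (P : B ⊗[k] W →ₗ[k] W ⊗[k] B) (ν : W ⊗[k] W →ₗ[k] W ⊗[k] B)

/-- The conditions defining a mirror version `W ⊗̄_{P,ν} B` of the Brzeziński crossed
product. -/
structure IsMirrorBrzezinskiCrossedProduct : Prop where
  P_one : ∀ b : B, P (b ⊗ₜ oneW) = oneW ⊗ₜ b
  one_P : ∀ w : W, P ((1 : B) ⊗ₜ w) = w ⊗ₜ (1 : B)
  nu_one : ∀ w : W, ν (w ⊗ₜ oneW) = w ⊗ₜ (1 : B)
  one_nu : ∀ w : W, ν (oneW ⊗ₜ w) = w ⊗ₜ (1 : B)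
  P_mul : ∀ (w : W) (b b' : B),
    P ((b * b') ⊗ₜ w) =
      lTensor W (LinearMap.mul' k B) (aso (rTensor B P (osa (b ⊗ₜ (P (b' ⊗ₜ w))))))
  compat : ∀ (w w' : W) (b : B),
    lTensor W (LinearMap.mul' k B) (aso (rTensor B ν
        (osa (lTensor W P (aso ((P (b ⊗ₜ w)) ⊗ₜ w')))))) =
      lTensor W (LinearMap.mul' k B) (aso (rTensor B P (osa (b ⊗ₜ (ν (w ⊗ₜ w'))))))
  cocycle : ∀ (w w' w'' : W),
    lTensor W (LinearMap.mul' k B) (aso (rTensor B ν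
        (osa (lTensor W P (aso ((ν (w ⊗ₜ w')) ⊗ₜ w'')))))) =
      lTensor W (LinearMap.mul' k B) (aso (rTensor B ν (osa (w ⊗ₜ (ν (w' ⊗ₜ w''))))))

end Mirror

section MirrorProduct

variable {k : Type*} [Field k] {B V W : Type*} [Ring B] [Algebra k B]
  [AddCommGroup V] [Module k V] [AddCommGroup W] [Module k W]

/-- A linear map `f : V ⊗ W → W ⊗ B` extends to an action of `V` on the free right `B`-module
`W ⊗ B`, by `v · (w ⊗ b) = f (v ⊗ w) b`. -/
def freeAct (f : V ⊗[k] W →ₗ[k] W ⊗[k] B) : V →ₗ[k] Module.End k (W ⊗[k] B) :=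
  curry (lTensor W (LinearMap.mul' k B) ∘ₗ aso ∘ₗ rTensor B f ∘ₗ osa)

theorem freeAct_apply (f : V ⊗[k] W →ₗ[k] W ⊗[k] B) (v : V) (y : W ⊗[k] B) :
    freeAct f v y = lTensor W (LinearMap.mul' k B) (aso (rTensor B f (osa (v ⊗ₜ y)))) :=
  rfl

theorem lTensor_mul'_aso_tmul (x : W ⊗[k] B) (b : B) :
    lTensor W (LinearMap.mul' k B) (aso (x ⊗ₜ b)) = lTensor W (LinearMap.mulRight k b) x := by
  induction x with
  | zero => simp
  | add x y hx hy => simp [add_tmul, hx, hy]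
  | tmul w c => simp [aso]

theorem freeAct_tmul (f : V ⊗[k] W →ₗ[k] W ⊗[k] B) (v : V) (w : W) (b : B) :
    freeAct f v (w ⊗ₜ b) = lTensor W (LinearMap.mulRight k b) (f (v ⊗ₜ w)) := by
  rw [freeAct_apply, ← lTensor_mul'_aso_tmul]
  simp [osa]

theorem lTensor_mulRight_one (x : W ⊗[k] B) :
    lTensor W (LinearMap.mulRight k (1 : B)) x = x := by
  simp

theorem lTensor_mulRight_mul (b c : B) (x : W ⊗[k] B) :
    lTensor W (LinearMap.mulRight k (b * c)) x =
      lTensor W (LinearMap.mulRight k c) (lTensor W (LinearMap.mulRight k b) x) := by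
  rw [LinearMap.mulRight_mul, lTensor_comp_apply]

theorem freeAct_mulRight (f : V ⊗[k] W →ₗ[k] W ⊗[k] B) (v : V) (c : B) (y : W ⊗[k] B) :
    freeAct f v (lTensor W (LinearMap.mulRight k c) y) =
      lTensor W (LinearMap.mulRight k c) (freeAct f v y) := by
  induction y with
  | zero => simp
  | add x y hx hy => simp only [map_add, hx, hy]
  | tmul w b =>
    rw [lTensor_tmul, mulRight_apply, freeAct_tmul, freeAct_tmul, lTensor_mulRight_mul]

theorem freeAct_tmul_one (f : V ⊗[k] W →ₗ[k] W ⊗[k] B) (v : V) (w : W) :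
    freeAct f v (w ⊗ₜ 1) = f (v ⊗ₜ w) := by
  rw [freeAct_tmul, lTensor_mulRight_one]

theorem end_ext_of_mulRight {S T : Module.End k (W ⊗[k] B)}
    (hS : ∀ c y, S (lTensor W (LinearMap.mulRight k c) y) =
      lTensor W (LinearMap.mulRight k c) (S y))
    (hT : ∀ c y, T (lTensor W (LinearMap.mulRight k c) y) =
      lTensor W (LinearMap.mulRight k c) (T y))
    (h : ∀ w : W, S (w ⊗ₜ 1) = T (w ⊗ₜ 1)) : S = T := by
  refine TensorProduct.ext' fun w b => ?_
  have hb : w ⊗ₜ[k] b = lTensor W (LinearMap.mulRight k b) (w ⊗ₜ[k] (1 : B)) := by simp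
  rw [hb, hS, hT, h]

/-- The multiplication `(w ⊗ b)(w' ⊗ b') = ν₁(w, w'_P) ⊗ ν₂(w, w'_P) b_P b'` on `W ⊗ B`. -/
def mirrorMul (P : B ⊗[k] W →ₗ[k] W ⊗[k] B) (ν : W ⊗[k] W →ₗ[k] W ⊗[k] B) :
    W ⊗[k] B →ₗ[k] Module.End k (W ⊗[k] B) :=
  TensorProduct.lift
    ((LinearMap.mul k (Module.End k (W ⊗[k] B))).compl₁₂ (freeAct ν) (freeAct P))

variable {oneW : W} {P : B ⊗[k] W →ₗ[k] W ⊗[k] B} {ν : W ⊗[k] W →ₗ[k] W ⊗[k] B}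

theorem mirrorMul_tmul (w : W) (b : B) :
    mirrorMul P ν (w ⊗ₜ b) = freeAct ν w * freeAct P b :=
  rfl

theorem mirrorMul_mulRight (x : W ⊗[k] B) (c : B) (y : W ⊗[k] B) :
    mirrorMul P ν x (lTensor W (LinearMap.mulRight k c) y) =
      lTensor W (LinearMap.mulRight k c) (mirrorMul P ν x y) := by
  induction x with
  | zero => simp
  | add x z hx hz => simp only [map_add, LinearMap.add_apply, hx, hz]
  | tmul w b => simp only [mirrorMul_tmul, Module.End.mul_apply, freeAct_mulRight]

theorem mirrorMul_tmul_one (x : W ⊗[k] B) (w : W) :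
    mirrorMul P ν x (w ⊗ₜ 1) = lTensor W (LinearMap.mul' k B) (aso (rTensor B ν
      (osa (lTensor W P (aso (x ⊗ₜ w)))))) := by
  induction x with
  | zero => simp
  | add x z hx hz => simp only [map_add, LinearMap.add_apply, add_tmul, hx, hz]
  | tmul v b =>
    rw [mirrorMul_tmul, Module.End.mul_apply, freeAct_tmul_one, freeAct_apply]
    simp [aso]

namespace IsMirrorBrzezinskiCrossedProduct

theorem freeAct_mul (h : IsMirrorBrzezinskiCrossedProduct oneW P ν) (b c : B) :
    freeAct P (b * c) = freeAct P b * freeAct P c := by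
  refine end_ext_of_mulRight (freeAct_mulRight _ _)
    (fun d y => by simp only [Module.End.mul_apply, freeAct_mulRight]) fun w => ?_
  rw [Module.End.mul_apply, freeAct_tmul_one, freeAct_tmul_one, h.P_mul, freeAct_apply]

theorem freeAct_mul_freeAct (h : IsMirrorBrzezinskiCrossedProduct oneW P ν) (b : B) (w : W) :
    freeAct P b * freeAct ν w = mirrorMul P ν (P (b ⊗ₜ w)) := by
  refine end_ext_of_mulRight (fun d y => by simp only [Module.End.mul_apply, freeAct_mulRight])
    (mirrorMul_mulRight _) fun w' => ?_
  rw [Module.End.mul_apply, freeAct_tmul_one, mirrorMul_tmul_one, h.compat, freeAct_apply]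

theorem freeAct_nu_mul_freeAct_nu (h : IsMirrorBrzezinskiCrossedProduct oneW P ν) (w w' : W) :
    freeAct ν w * freeAct ν w' = mirrorMul P ν (ν (w ⊗ₜ w')) := by
  refine end_ext_of_mulRight (fun d y => by simp only [Module.End.mul_apply, freeAct_mulRight])
    (mirrorMul_mulRight _) fun w'' => ?_
  rw [Module.End.mul_apply, freeAct_tmul_one, mirrorMul_tmul_one, h.cocycle, freeAct_apply]

theorem mirrorMul_lTensor_mulRight (h : IsMirrorBrzezinskiCrossedProduct oneW P ν)
    (x : W ⊗[k] B) (c : B) :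
    mirrorMul P ν (lTensor W (LinearMap.mulRight k c) x) = mirrorMul P ν x * freeAct P c := by
  induction x with
  | zero => simp
  | add x y hx hy => simp only [map_add, add_mul, hx, hy]
  | tmul w b =>
    rw [lTensor_tmul, mulRight_apply, mirrorMul_tmul, mirrorMul_tmul, h.freeAct_mul, mul_assoc]

theorem mirrorMul_freeAct_P (h : IsMirrorBrzezinskiCrossedProduct oneW P ν)
    (b : B) (y : W ⊗[k] B) :
    mirrorMul P ν (freeAct P b y) = freeAct P b * mirrorMul P ν y := by
  induction y with
  | zero => simp
  | add x y hx hy => simp only [map_add, mul_add, hx, hy]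
  | tmul w c =>
    rw [freeAct_tmul, h.mirrorMul_lTensor_mulRight, ← h.freeAct_mul_freeAct, mirrorMul_tmul,
      mul_assoc]

theorem mirrorMul_freeAct_nu (h : IsMirrorBrzezinskiCrossedProduct oneW P ν)
    (w : W) (y : W ⊗[k] B) :
    mirrorMul P ν (freeAct ν w y) = freeAct ν w * mirrorMul P ν y := by
  induction y with
  | zero => simp
  | add x y hx hy => simp only [map_add, mul_add, hx, hy]
  | tmul w' c =>
    rw [freeAct_tmul, h.mirrorMul_lTensor_mulRight, ← h.freeAct_nu_mul_freeAct_nu,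
      mirrorMul_tmul, mul_assoc]

theorem mirrorMul_mirrorMul (h : IsMirrorBrzezinskiCrossedProduct oneW P ν)
    (x y : W ⊗[k] B) :
    mirrorMul P ν (mirrorMul P ν x y) = mirrorMul P ν x * mirrorMul P ν y := by
  induction x with
  | zero => simp
  | add x z hx hz => simp only [map_add, LinearMap.add_apply, add_mul, hx, hz]
  | tmul w b =>
    rw [mirrorMul_tmul, Module.End.mul_apply, h.mirrorMul_freeAct_nu, h.mirrorMul_freeAct_P,
      mul_assoc]

theorem mirrorMul_one (h : IsMirrorBrzezinskiCrossedProduct oneW P ν) :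
    mirrorMul P ν (oneW ⊗ₜ 1) = 1 := by
  refine end_ext_of_mulRight (mirrorMul_mulRight _) (fun _ _ => rfl) fun w => ?_
  rw [mirrorMul_tmul, Module.End.mul_apply, freeAct_tmul_one, h.one_P, freeAct_tmul_one,
    h.one_nu, Module.End.one_apply]

theorem mirrorMul_apply_one (h : IsMirrorBrzezinskiCrossedProduct oneW P ν) (x : W ⊗[k] B) :
    mirrorMul P ν x (oneW ⊗ₜ 1) = x := by
  induction x with
  | zero => simp
  | add x y hx hy => simp only [map_add, LinearMap.add_apply, hx, hy]
  | tmul w b =>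
    rw [mirrorMul_tmul, Module.End.mul_apply, freeAct_tmul_one, h.P_one, freeAct_tmul, h.nu_one]
    simp

end IsMirrorBrzezinskiCrossedProduct

theorem freeAct_eq_rTensor_mk (f : V ⊗[k] W →ₗ[k] W ⊗[k] B) (v : V) (y : W ⊗[k] B) :
    freeAct f v y = lTensor W (LinearMap.mul' k B)
      (aso (rTensor B (f ∘ₗ TensorProduct.mk k V W v) y)) := by
  induction y with
  | zero => simp
  | add x y hx hy => simp only [map_add, hx, hy]
  | tmul w b => rw [freeAct_tmul, rTensor_tmul, lTensor_mul'_aso_tmul]; rfl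

end MirrorProduct


/-- If `P`, `ν` satisfy the mirror Brzeziński crossed product conditions,
then the mirror Brzeziński crossed product `W ⊗̄_{P,ν} B`, i.e. `W ⊗ B` with the (bilinear)
multiplication determined by `(w⊗b)(w'⊗b') = ν₁(w,w'_P) ⊗ ν₂(w,w'_P) b_P b'`, is an
associative unital algebra with unit `1_W ⊗ 1_B`. -/
theorem mirror_brzezinski_crossed_product_is_unital_associative_algebra
    {k : Type*} [Field k] {B W : Type*} [Ring B] [Algebra k B]
    [AddCommGroup W] [Module k W] (oneW : W)
    (P : B ⊗[k] W →ₗ[k] W ⊗[k] B) (ν : W ⊗[k] W →ₗ[k] W ⊗[k] B)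
    (hPν : IsMirrorBrzezinskiCrossedProduct oneW P ν) :
    ∃ mul : W ⊗[k] B →ₗ[k] W ⊗[k] B →ₗ[k] W ⊗[k] B,
      (∀ (w w' : W) (b b' : B),
        mul (w ⊗ₜ b) (w' ⊗ₜ b') =
          lTensor W (LinearMap.mulRight k b')
        (lTensor W (LinearMap.mul' k B) (aso (rTensor B
          (ν ∘ₗ (TensorProduct.mk k W W) w) (P (b ⊗ₜ w')))))) ∧
      (∀ x y z : W ⊗[k] B, mul (mul x y) z = mul x (mul y z)) ∧
      (∀ x : W ⊗[k] B, mul (oneW ⊗ₜ (1 : B)) x = x) ∧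
      (∀ x : W ⊗[k] B, mul x (oneW ⊗ₜ (1 : B)) = x) := by
  refine ⟨mirrorMul P ν, fun w w' b b' => ?_, fun x y z => ?_, fun x => ?_,
    hPν.mirrorMul_apply_one⟩
  · rw [mirrorMul_tmul, Module.End.mul_apply, freeAct_tmul, freeAct_mulRight,
      freeAct_eq_rTensor_mk]
  · rw [hPν.mirrorMul_mirrorMul, Module.End.mul_apply]
  · rw [hPν.mirrorMul_one, Module.End.one_apply]
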